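/- Let h be a Haar state on O(SL_q(2)). Then the Haar state satisfies the modular property h(xy) = h(ϑ(y)x) with ϑ(y) = q^{m+n}y on A[m,n]: for all integers m, n, all x ∈ A, and all y ∈ A[m,n], h(xy) = q^{m+n} h(yx). -/

import Mathlib

open scoped TensorProduct
open LaurentPolynomial

noncomputable section

namespace SLq2

/-- Free algebra on the four generators `a, b, c, d` (indexed `0,1,2,3`). -/
abbrev F : Type := FreeAlgebra ℂ (Fin 4)

/-- The generators of the free algebra. -/
def X (i : Fin 4) : F := FreeAlgebra.ι ℂ i

/-- The defining relations of `O(SL_q(2))`: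
`ab = q ba`, `ac = q ca`, `bd = q db`, `cd = q dc`, `bc = cb`,
`ad - da = (q - q⁻¹) bc`, `ad - q bc = 1`. -/
inductive Rel (q : ℝ) : F → F → Prop
  | ab : Rel q (X 0 * X 1) ((q : ℂ) • (X 1 * X 0))
  | ac : Rel q (X 0 * X 2) ((q : ℂ) • (X 2 * X 0))
  | bd : Rel q (X 1 * X 3) ((q : ℂ) • (X 3 * X 1))
  | cd : Rel q (X 2 * X 3) ((q : ℂ) • (X 3 * X 2))
  | bc : Rel q (X 1 * X 2) (X 2 * X 1)
  | adda : Rel q (X 0 * X 3 - X 3 * X 0) (((q : ℂ) - (q : ℂ)⁻¹) • (X 1 * X 2))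
  | det : Rel q (X 0 * X 3 - (q : ℂ) • (X 1 * X 2)) 1

/-- `O(SL_q(2))`, the universal `ℂ`-algebra on `a,b,c,d` with the above relations. -/
abbrev A (q : ℝ) : Type := RingQuot (Rel q)

def a (q : ℝ) : A q := RingQuot.mkAlgHom ℂ (Rel q) (X 0)
def b (q : ℝ) : A q := RingQuot.mkAlgHom ℂ (Rel q) (X 1)
def c (q : ℝ) : A q := RingQuot.mkAlgHom ℂ (Rel q) (X 2)
def d (q : ℝ) : A q := RingQuot.mkAlgHom ℂ (Rel q) (X 3)

variable {q : ℝ}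

/-- `L_K = (φ ⊗ id) ∘ Δ`. -/
def LK (Δ : A q →ₐ[ℂ] A q ⊗[ℂ] A q) (φ : A q →ₐ[ℂ] LaurentPolynomial ℂ) :
    A q →ₗ[ℂ] LaurentPolynomial ℂ ⊗[ℂ] A q :=
  (TensorProduct.map φ.toLinearMap LinearMap.id).comp Δ.toLinearMap

/-- `R_K = (id ⊗ φ) ∘ Δ`. -/
def RK (Δ : A q →ₐ[ℂ] A q ⊗[ℂ] A q) (φ : A q →ₐ[ℂ] LaurentPolynomial ℂ) :
    A q →ₗ[ℂ] A q ⊗[ℂ] LaurentPolynomial ℂ :=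
  (TensorProduct.map LinearMap.id φ.toLinearMap).comp Δ.toLinearMap

/-- The subspace `A[m,n] = {x | L_K x = zᵐ ⊗ x, R_K x = x ⊗ zⁿ}`. -/
def Asub (Δ : A q →ₐ[ℂ] A q ⊗[ℂ] A q) (φ : A q →ₐ[ℂ] LaurentPolynomial ℂ)
    (m n : ℤ) : Submodule ℂ (A q) where
  carrier := {x | LK Δ φ x = T m ⊗ₜ[ℂ] x ∧ RK Δ φ x = x ⊗ₜ[ℂ] T n}
  add_mem' := by
    rintro x y ⟨hx1, hx2⟩ ⟨hy1, hy2⟩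
    exact ⟨by simp [map_add, hx1, hy1, TensorProduct.tmul_add],
           by simp [map_add, hx2, hy2, TensorProduct.add_tmul]⟩
  zero_mem' := ⟨by simp, by simp⟩
  smul_mem' := by
    rintro t x ⟨h1, h2⟩
    exact ⟨by simp [map_smul, h1, TensorProduct.tmul_smul],
           by simp [map_smul, h2, TensorProduct.smul_tmul']⟩

/-- `h` is a Haar state: `h(1) = 1`, `(id ⊗ h)(Δ x) = h(x)·1` and `(h ⊗ id)(Δ x) = h(x)·1`. -/
def IsHaarState (Δ : A q →ₐ[ℂ] A q ⊗[ℂ] A q) (h : A q →ₗ[ℂ] ℂ) : Prop :=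
  h 1 = 1 ∧
  (∀ x : A q, (TensorProduct.rid ℂ (A q)) ((LinearMap.lTensor (A q) h) (Δ x)) = h x • 1) ∧
  (∀ x : A q, (TensorProduct.lid ℂ (A q)) ((LinearMap.rTensor (A q) h) (Δ x)) = h x • 1)
section Relations

theorem a_mul_b : a q * b q = (q : ℂ) • (b q * a q) := by
  simpa [a, b, -Complex.coe_smul] using RingQuot.mkAlgHom_rel ℂ (Rel.ab (q := q))

theorem a_mul_c : a q * c q = (q : ℂ) • (c q * a q) := by
  simpa [a, c, -Complex.coe_smul] using RingQuot.mkAlgHom_rel ℂ (Rel.ac (q := q))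

theorem b_mul_d : b q * d q = (q : ℂ) • (d q * b q) := by
  simpa [b, d, -Complex.coe_smul] using RingQuot.mkAlgHom_rel ℂ (Rel.bd (q := q))

theorem c_mul_d : c q * d q = (q : ℂ) • (d q * c q) := by
  simpa [c, d, -Complex.coe_smul] using RingQuot.mkAlgHom_rel ℂ (Rel.cd (q := q))

theorem commute_b_c : Commute (b q) (c q) := by
  simpa [b, c, commute_iff_eq] using RingQuot.mkAlgHom_rel ℂ (Rel.bc (q := q))

theorem a_mul_d : a q * d q = 1 + (q : ℂ) • (b q * c q) := by
  have : a q * d q - (q : ℂ) • (b q * c q) = 1 := by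
    simpa [a, b, c, d, -Complex.coe_smul] using RingQuot.mkAlgHom_rel ℂ (Rel.det (q := q))
  rw [← this, sub_add_cancel]

theorem d_mul_a : d q * a q = 1 + (q : ℂ)⁻¹ • (b q * c q) := by
  have : a q * d q - d q * a q = ((q : ℂ) - (q : ℂ)⁻¹) • (b q * c q) := by
    simpa [a, b, c, d, -Complex.coe_smul] using RingQuot.mkAlgHom_rel ℂ (Rel.adda (q := q))
  have hsub : ((q : ℂ) - (q : ℂ)⁻¹) • (b q * c q) =
      (q : ℂ) • (b q * c q) - (q : ℂ)⁻¹ • (b q * c q) := by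
    simp only [Algebra.smul_def, map_sub, sub_mul]
  rw [a_mul_d, hsub] at this
  rw [← sub_eq_zero, ← neg_eq_zero, ← sub_eq_zero.2 this]
  abel

theorem d_mul_b (hq : (q : ℂ) ≠ 0) : d q * b q = (q : ℂ)⁻¹ • (b q * d q) := by
  rw [b_mul_d, inv_smul_smul₀ hq]

theorem d_mul_c (hq : (q : ℂ) ≠ 0) : d q * c q = (q : ℂ)⁻¹ • (c q * d q) := by
  rw [c_mul_d, inv_smul_smul₀ hq]

theorem mul_mul_of_mul_eq_smul {R : Type*} [Ring R] [Algebra ℂ R] {x y z : R} {s t : ℂ}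
    (hy : x * y = s • (y * x)) (hz : x * z = t • (z * x)) :
    x * (y * z) = (s * t) • (y * z * x) := by
  rw [← mul_assoc, hy, smul_mul_assoc, mul_assoc, hz, mul_smul_comm, smul_smul, mul_assoc]

theorem mul_pow_of_mul_eq_smul {R : Type*} [Ring R] [Algebra ℂ R] {x y : R} {s : ℂ}
    (hy : x * y = s • (y * x)) (n : ℕ) : x * y ^ n = s ^ n • (y ^ n * x) := by
  induction n with
  | zero => simp
  | succ n ih => rw [pow_succ, pow_succ, mul_mul_of_mul_eq_smul ih hy]

theorem a_mul_pow_mul_pow (j k : ℕ) :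
    a q * (b q ^ j * c q ^ k) = ((q : ℂ) ^ j * (q : ℂ) ^ k) • (b q ^ j * c q ^ k * a q) :=
  mul_mul_of_mul_eq_smul (mul_pow_of_mul_eq_smul a_mul_b j) (mul_pow_of_mul_eq_smul a_mul_c k)

theorem d_mul_pow_mul_pow (hq : (q : ℂ) ≠ 0) (j k : ℕ) :
    d q * (b q ^ j * c q ^ k) =
      ((q : ℂ)⁻¹ ^ j * (q : ℂ)⁻¹ ^ k) • (b q ^ j * c q ^ k * d q) :=
  mul_mul_of_mul_eq_smul (mul_pow_of_mul_eq_smul (d_mul_b hq) j)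
    (mul_pow_of_mul_eq_smul (d_mul_c hq) k)

end Relations

section Generation

theorem adjoin_generators : Algebra.adjoin ℂ {a q, b q, c q, d q} = ⊤ := by
  rw [eq_top_iff]
  rintro x -
  obtain ⟨y, rfl⟩ := RingQuot.mkAlgHom_surjective ℂ (Rel q) x
  induction y using FreeAlgebra.induction with
  | grade0 r =>
    rw [AlgHom.commutes]
    exact Subalgebra.algebraMap_mem _ r
  | grade1 i =>
    apply Algebra.subset_adjoin
    fin_cases i
    · exact Or.inl rfl
    · exact Or.inr (Or.inl rfl)
    · exact Or.inr (Or.inr (Or.inl rfl))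
    · exact Or.inr (Or.inr (Or.inr rfl))
  | mul x y hx hy => rw [map_mul]; exact mul_mem hx hy
  | add x y hx hy => rw [map_add]; exact add_mem hx hy

theorem eq_top_of_generators_mem {S : Subalgebra ℂ (A q)} (ha : a q ∈ S) (hb : b q ∈ S)
    (hc : c q ∈ S) (hd : d q ∈ S) : S = ⊤ := by
  rw [eq_top_iff, ← adjoin_generators, Algebra.adjoin_le_iff]
  rintro x (rfl | rfl | rfl | rfl) <;> assumption

/-- The monomials `bʲ cᵏ aⁱ` and `bʲ cᵏ dⁱ`, which span `O(SL_q(2))`. -/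
def monomials (q : ℝ) : Set (A q) :=
  {x | ∃ j k i : ℕ, x = b q ^ j * c q ^ k * a q ^ i ∨ x = b q ^ j * c q ^ k * d q ^ i}

theorem left_mul_mem_span_of_monomials {y : A q}
    (hy : ∀ x ∈ monomials q, y * x ∈ Submodule.span ℂ (monomials q)) :
    ∀ x ∈ Submodule.span ℂ (monomials q), y * x ∈ Submodule.span ℂ (monomials q) := by
  have : Submodule.span ℂ (monomials q) ≤
      (Submodule.span ℂ (monomials q)).comap (LinearMap.mulLeft ℂ y) :=
    Submodule.span_le.2 hy
  exact this

theorem monomial_a_mem_span (j k i : ℕ) :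
    b q ^ j * c q ^ k * a q ^ i ∈ Submodule.span ℂ (monomials q) :=
  Submodule.subset_span ⟨j, k, i, Or.inl rfl⟩

theorem monomial_d_mem_span (j k i : ℕ) :
    b q ^ j * c q ^ k * d q ^ i ∈ Submodule.span ℂ (monomials q) :=
  Submodule.subset_span ⟨j, k, i, Or.inr rfl⟩

theorem pow_mul_pow_mul_b_mul_c (j k : ℕ) :
    b q ^ j * c q ^ k * (b q * c q) = b q ^ (j + 1) * c q ^ (k + 1) := by
  have h := (commute_b_c (q := q)).pow_right k
  rw [mul_assoc, ← mul_assoc (c q ^ k), ← h.eq, pow_succ, pow_succ]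
  simp only [mul_assoc]

theorem span_monomials (hq : (q : ℂ) ≠ 0) : Submodule.span ℂ (monomials q) = ⊤ := by
  let S : Subalgebra ℂ (A q) :=
    { carrier := {y | ∀ x ∈ Submodule.span ℂ (monomials q),
        y * x ∈ Submodule.span ℂ (monomials q)}
      mul_mem' := fun {y z} hy hz x hx => by rw [mul_assoc]; exact hy _ (hz _ hx)
      add_mem' := fun {y z} hy hz x hx => by
        rw [add_mul]; exact add_mem (hy _ hx) (hz _ hx)
      algebraMap_mem' := fun r x hx => by
        rw [← Algebra.smul_def]; exact Submodule.smul_mem _ _ hx }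
  have hS : S = ⊤ := by
    apply eq_top_of_generators_mem
    · refine left_mul_mem_span_of_monomials ?_
      rintro _ ⟨j, k, i, rfl | rfl⟩ <;>
        rw [← mul_assoc, a_mul_pow_mul_pow, smul_mul_assoc] <;>
        refine Submodule.smul_mem _ _ ?_
      · rw [mul_assoc, ← pow_succ']
        exact monomial_a_mem_span j k _
      · cases i with
        | zero => simpa using monomial_a_mem_span (q := q) j k 1
        | succ i =>
          rw [pow_succ', ← mul_assoc, mul_assoc _ (a q), a_mul_d, mul_add, mul_one,
            mul_smul_comm, pow_mul_pow_mul_b_mul_c, add_mul, smul_mul_assoc]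
          exact add_mem (monomial_d_mem_span _ _ _)
            (Submodule.smul_mem _ _ (monomial_d_mem_span _ _ _))
    · refine left_mul_mem_span_of_monomials ?_
      rintro _ ⟨j, k, i, rfl | rfl⟩ <;> rw [← mul_assoc, ← mul_assoc, ← pow_succ']
      · exact monomial_a_mem_span _ _ _
      · exact monomial_d_mem_span _ _ _
    · refine left_mul_mem_span_of_monomials ?_
      rintro _ ⟨j, k, i, rfl | rfl⟩ <;>
        rw [← mul_assoc, ← mul_assoc, ← ((commute_b_c (q := q)).pow_left j).eq,
          mul_assoc (b q ^ j), ← pow_succ']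
      · exact monomial_a_mem_span _ _ _
      · exact monomial_d_mem_span _ _ _
    · refine left_mul_mem_span_of_monomials ?_
      rintro _ ⟨j, k, i, rfl | rfl⟩ <;>
        rw [← mul_assoc, d_mul_pow_mul_pow hq, smul_mul_assoc] <;>
        refine Submodule.smul_mem _ _ ?_
      · cases i with
        | zero => simpa using monomial_d_mem_span (q := q) j k 1
        | succ i =>
          rw [pow_succ', ← mul_assoc, mul_assoc _ (d q), d_mul_a, mul_add, mul_one,
            mul_smul_comm, pow_mul_pow_mul_b_mul_c, add_mul, smul_mul_assoc]
          exact add_mem (monomial_a_mem_span _ _ _)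
            (Submodule.smul_mem _ _ (monomial_a_mem_span _ _ _))
      · rw [mul_assoc, ← pow_succ']
        exact monomial_d_mem_span j k _
  rw [eq_top_iff]
  rintro x -
  have hx : x ∈ S := hS ▸ Algebra.mem_top
  simpa using hx 1 (by simpa using monomial_a_mem_span (q := q) 0 0 0)

end Generation

section Actions

/-- Left translation `(χ ⊗ id) ∘ Δ` by a character `χ`. -/
def leftTranslation (Δ : A q →ₐ[ℂ] A q ⊗[ℂ] A q) (χ : A q →ₐ[ℂ] ℂ) : A q →ₐ[ℂ] A q :=
  (Algebra.TensorProduct.lid ℂ (A q)).toAlgHom.comp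
    ((Algebra.TensorProduct.map χ (AlgHom.id ℂ (A q))).comp Δ)

/-- Right translation `(id ⊗ χ) ∘ Δ` by a character `χ`. -/
def rightTranslation (Δ : A q →ₐ[ℂ] A q ⊗[ℂ] A q) (χ : A q →ₐ[ℂ] ℂ) : A q →ₐ[ℂ] A q :=
  (Algebra.TensorProduct.rid ℂ ℂ (A q)).toAlgHom.comp
    ((Algebra.TensorProduct.map (AlgHom.id ℂ (A q)) χ).comp Δ)

/-- The action `(id ⊗ π) ∘ Δ` of a two-dimensional representation `π` on the right leg of `Δ`. -/
def rightMatrixAction (Δ : A q →ₐ[ℂ] A q ⊗[ℂ] A q)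
    (π : A q →ₐ[ℂ] Matrix (Fin 2) (Fin 2) ℂ) : A q →ₐ[ℂ] Matrix (Fin 2) (Fin 2) (A q) :=
  (matrixEquivTensor (Fin 2) ℂ (A q)).symm.toAlgHom.comp
    ((Algebra.TensorProduct.map (AlgHom.id ℂ (A q)) π).comp Δ)

variable {Δ : A q →ₐ[ℂ] A q ⊗[ℂ] A q} {h : A q →ₗ[ℂ] ℂ}

theorem haar_leftTranslation (hh : IsHaarState Δ h) (χ : A q →ₐ[ℂ] ℂ) (x : A q) :
    h (leftTranslation Δ χ x) = h x := by
  have key : ∀ t : A q ⊗[ℂ] A q,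
      h (Algebra.TensorProduct.lid ℂ (A q)
        (Algebra.TensorProduct.map χ (AlgHom.id ℂ (A q)) t)) =
      χ (TensorProduct.rid ℂ (A q) (LinearMap.lTensor (A q) h t)) := by
    intro t
    induction t with
    | zero => simp
    | tmul x y => simp [mul_comm]
    | add x y hx hy => simp only [map_add, hx, hy]
  have := key (Δ x)
  rw [hh.2.1] at this
  simpa [leftTranslation] using this

theorem haar_rightTranslation (hh : IsHaarState Δ h) (χ : A q →ₐ[ℂ] ℂ) (x : A q) :
    h (rightTranslation Δ χ x) = h x := by
  have key : ∀ t : A q ⊗[ℂ] A q,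
      h (Algebra.TensorProduct.rid ℂ ℂ (A q)
        (Algebra.TensorProduct.map (AlgHom.id ℂ (A q)) χ t)) =
      χ (TensorProduct.lid ℂ (A q) (LinearMap.rTensor (A q) h t)) := by
    intro t
    induction t with
    | zero => simp
    | tmul x y => simp [mul_comm]
    | add x y hx hy => simp only [map_add, hx, hy]
  have := key (Δ x)
  rw [hh.2.2] at this
  simpa [rightTranslation] using this

theorem haar_rightMatrixAction (hh : IsHaarState Δ h)
    (π : A q →ₐ[ℂ] Matrix (Fin 2) (Fin 2) ℂ) (x : A q) :
    h (rightMatrixAction Δ π x 0 1) = 0 := by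
  have key : ∀ t : A q ⊗[ℂ] A q,
      h ((matrixEquivTensor (Fin 2) ℂ (A q)).symm
        (Algebra.TensorProduct.map (AlgHom.id ℂ (A q)) π t) 0 1) =
      π (TensorProduct.lid ℂ (A q) (LinearMap.rTensor (A q) h t)) 0 1 := by
    intro t
    induction t with
    | zero => simp
    | tmul x y =>
      simp [matrixEquivTensor_apply_symm, ← Algebra.commutes, ← Algebra.smul_def, mul_comm]
    | add x y hx hy => simp only [map_add, Matrix.add_apply, hx, hy]
  have := key (Δ x)
  rw [hh.2.2] at this
  simpa [rightMatrixAction] using this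

/-- The two-dimensional representation of `O(SL_q(2))` with `a ↦ diag(q, 1)`, `b ↦ 0`,
`c ↦ E₀₁`, `d ↦ diag(q⁻¹, 1)`; its `(0, 1)` entry is a twisted derivation `O(SL_q(2)) → ℂ`. -/
def skewRep (hq : (q : ℂ) ≠ 0) : A q →ₐ[ℂ] Matrix (Fin 2) (Fin 2) ℂ :=
  RingQuot.liftAlgHom ℂ ⟨FreeAlgebra.lift ℂ
    ![!![(q : ℂ), 0; 0, 1], 0, !![0, 1; 0, 0], !![(q : ℂ)⁻¹, 0; 0, 1]], by
      intro x y hxy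
      cases hxy <;> ext i j <;> fin_cases i <;> fin_cases j <;> simp [X, hq, -Complex.coe_smul]⟩

theorem skewRep_a (hq : (q : ℂ) ≠ 0) : skewRep hq (a q) = !![(q : ℂ), 0; 0, 1] := by
  simp [skewRep, a, X, RingQuot.liftAlgHom_mkAlgHom_apply]

theorem skewRep_b (hq : (q : ℂ) ≠ 0) : skewRep hq (b q) = 0 := by
  simp [skewRep, b, X, RingQuot.liftAlgHom_mkAlgHom_apply]

theorem skewRep_c (hq : (q : ℂ) ≠ 0) : skewRep hq (c q) = !![0, 1; 0, 0] := by
  simp [skewRep, c, X, RingQuot.liftAlgHom_mkAlgHom_apply]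

theorem skewRep_d (hq : (q : ℂ) ≠ 0) : skewRep hq (d q) = !![(q : ℂ)⁻¹, 0; 0, 1] := by
  simp [skewRep, d, X, RingQuot.liftAlgHom_mkAlgHom_apply]

end Actions

section Weights

variable {l r : A q →ₐ[ℂ] A q} {h : A q →ₗ[ℂ] ℂ} {m n m' n' : ℤ} {x y : A q}

/-- The endomorphisms `l` and `r` are left and right translation by the torus element `q`. -/
structure IsTorusPair (l r : A q →ₐ[ℂ] A q) : Prop where
  left_a : l (a q) = (q : ℂ) • a q
  left_b : l (b q) = (q : ℂ) • b q
  left_c : l (c q) = (q : ℂ)⁻¹ • c q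
  left_d : l (d q) = (q : ℂ)⁻¹ • d q
  right_a : r (a q) = (q : ℂ) • a q
  right_b : r (b q) = (q : ℂ)⁻¹ • b q
  right_c : r (c q) = (q : ℂ) • c q
  right_d : r (d q) = (q : ℂ)⁻¹ • d q

/-- `x` is a joint eigenvector of `l` and `r` with eigenvalues `qᵐ` and `qⁿ`. -/
def HasWeight (l r : A q →ₐ[ℂ] A q) (m n : ℤ) (x : A q) : Prop :=
  l x = (q : ℂ) ^ m • x ∧ r x = (q : ℂ) ^ n • x

theorem HasWeight.mul (hq : (q : ℂ) ≠ 0) (hx : HasWeight l r m n x)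
    (hy : HasWeight l r m' n' y) : HasWeight l r (m + m') (n + n') (x * y) := by
  constructor
  · rw [map_mul, hx.1, hy.1, smul_mul_smul_comm, zpow_add₀ hq]
  · rw [map_mul, hx.2, hy.2, smul_mul_smul_comm, zpow_add₀ hq]

theorem HasWeight.pow (hx : HasWeight l r m n x) (k : ℕ) :
    HasWeight l r (m * k) (n * k) (x ^ k) := by
  constructor
  · rw [map_pow, hx.1, smul_pow, zpow_mul, zpow_natCast]
  · rw [map_pow, hx.2, smul_pow, zpow_mul, zpow_natCast]

theorem HasWeight.haar_eq_zero (hq0 : 0 < q) (hq1 : q < 1) (hl : ∀ x, h (l x) = h x)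
    (hr : ∀ x, h (r x) = h x) (hx : HasWeight l r m n x) (hmn : m ≠ 0 ∨ n ≠ 0) : h x = 0 := by
  have key : ∀ k : ℤ, k ≠ 0 → (q : ℂ) ^ k * h x = h x → h x = 0 := by
    intro k hk hkx
    have hne : (q : ℂ) ^ k ≠ 1 := by
      rw [← Complex.ofReal_zpow, Ne, Complex.ofReal_eq_one,
        zpow_eq_one_iff_right₀ hq0.le hq1.ne]
      exact hk
    by_contra hx0
    exact hne ((mul_eq_right₀ hx0).1 hkx)
  rcases hmn with hm | hn
  · exact key m hm (by rw [← smul_eq_mul, ← map_smul, ← hx.1, hl])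
  · exact key n hn (by rw [← smul_eq_mul, ← map_smul, ← hx.2, hr])

theorem HasWeight.haar_mul_eq (hq0 : 0 < q) (hq1 : q < 1) (hl : ∀ x, h (l x) = h x)
    (hr : ∀ x, h (r x) = h x) (hx : HasWeight l r m n x) (hy : HasWeight l r m' n' y)
    (hmn : m + m' ≠ 0 ∨ n + n' ≠ 0) (t : ℂ) : h (x * y) = t * h (y * x) := by
  have hq : (q : ℂ) ≠ 0 := Complex.ofReal_ne_zero.2 hq0.ne'
  rw [(hx.mul hq hy).haar_eq_zero hq0 hq1 hl hr hmn,
    (hy.mul hq hx).haar_eq_zero hq0 hq1 hl hr (by rwa [add_comm m', add_comm n']), mul_zero]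

namespace IsTorusPair

theorem hasWeight_a (hlr : IsTorusPair l r) : HasWeight l r 1 1 (a q) := by
  simp only [HasWeight, zpow_one, hlr.left_a, hlr.right_a, and_self]

theorem hasWeight_b (hlr : IsTorusPair l r) : HasWeight l r 1 (-1) (b q) := by
  simp only [HasWeight, zpow_one, zpow_neg, hlr.left_b, hlr.right_b, and_self]

theorem hasWeight_c (hlr : IsTorusPair l r) : HasWeight l r (-1) 1 (c q) := by
  simp only [HasWeight, zpow_one, zpow_neg, hlr.left_c, hlr.right_c, and_self]

theorem hasWeight_d (hlr : IsTorusPair l r) : HasWeight l r (-1) (-1) (d q) := by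
  simp only [HasWeight, zpow_one, zpow_neg, hlr.left_d, hlr.right_d, and_self]

theorem hasWeight_monomial_a (hlr : IsTorusPair l r) (hq : (q : ℂ) ≠ 0) (j k i : ℕ) :
    HasWeight l r (j - k + i) (-j + k + i) (b q ^ j * c q ^ k * a q ^ i) := by
  convert ((hlr.hasWeight_b.pow j).mul hq (hlr.hasWeight_c.pow k)).mul hq
    (hlr.hasWeight_a.pow i) using 1 <;> ring

theorem hasWeight_monomial_d (hlr : IsTorusPair l r) (hq : (q : ℂ) ≠ 0) (j k i : ℕ) :
    HasWeight l r (j - k - i) (-j + k - i) (b q ^ j * c q ^ k * d q ^ i) := by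
  convert ((hlr.hasWeight_b.pow j).mul hq (hlr.hasWeight_c.pow k)).mul hq
    (hlr.hasWeight_d.pow i) using 1 <;> ring

end IsTorusPair

end Weights

section Recursion

variable {Δ : A q →ₐ[ℂ] A q ⊗[ℂ] A q} {h : A q →ₗ[ℂ] ℂ}

theorem rightMatrixAction_b_mul_c_pow_mul_c (hq : (q : ℂ) ≠ 0)
    {D : A q →ₐ[ℂ] Matrix (Fin 2) (Fin 2) (A q)}
    (hDb : D (b q) = !![(q : ℂ)⁻¹ • b q, 0; 0, b q])
    (hDc : D (c q) = !![(q : ℂ) • c q, d q; 0, c q]) (k : ℕ) :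
    D ((b q * c q) ^ k * c q) =
      !![(q : ℂ) • ((b q * c q) ^ k * c q),
        (∑ i ∈ Finset.range (k + 1), ((q : ℂ)⁻¹ ^ 2) ^ i) • ((b q * c q) ^ k * d q);
        0, (b q * c q) ^ k * c q] := by
  induction k with
  | zero => simp [hDc, -Complex.coe_smul]
  | succ k ih =>
    have hd : d q * ((b q * c q) ^ k * c q) =
        (((q : ℂ)⁻¹ * (q : ℂ)⁻¹) ^ k * (q : ℂ)⁻¹) • ((b q * c q) ^ k * c q * d q) :=
      mul_mul_of_mul_eq_smul (mul_pow_of_mul_eq_smul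
        (mul_mul_of_mul_eq_smul (d_mul_b hq) (d_mul_c hq)) k) (d_mul_c hq)
    have hcomm : b q * ((b q * c q) ^ k * c q) = (b q * c q) ^ (k + 1) := by
      have : Commute (b q) ((b q * c q) ^ k) :=
        ((Commute.refl _).mul_right commute_b_c).pow_right k
      rw [← mul_assoc, this.eq, mul_assoc, pow_succ]
    have hbd : b q * d q * ((b q * c q) ^ k * c q) =
        (((q : ℂ)⁻¹ * (q : ℂ)⁻¹) ^ k * (q : ℂ)⁻¹) • ((b q * c q) ^ (k + 1) * d q) := by
      rw [mul_assoc, hd, mul_smul_comm, ← mul_assoc, hcomm]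
    have hDbc : D (b q * c q) = !![b q * c q, (q : ℂ)⁻¹ • (b q * d q); 0, b q * c q] := by
      rw [map_mul, hDb, hDc]
      ext i j
      fin_cases i <;> fin_cases j <;>
        simp [smul_smul, hq, -Complex.coe_smul, -Complex.ofReal_inv]
    rw [pow_succ', mul_assoc, map_mul, ih, hDbc, ← pow_succ', Finset.sum_range_succ _ (k + 1)]
    ext i j
    fin_cases i <;> fin_cases j
    · simp [← mul_assoc, ← pow_succ', -Complex.coe_smul]
    · simp only [Matrix.mul_apply, Fin.sum_univ_two]
      simp only [Fin.zero_eta, Fin.mk_one, Matrix.of_apply, Matrix.cons_val_zero,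
        Matrix.cons_val_one, smul_mul_assoc, mul_smul_comm]
      rw [hbd, ← mul_assoc, ← pow_succ', smul_smul, ← add_smul]
      congr 2
      ring
    · simp
    · simp [← mul_assoc, ← pow_succ']

theorem haar_b_mul_c_pow_mul_d_mul_a (hq : (q : ℂ) ≠ 0) (k : ℕ)
    {D : A q →ₐ[ℂ] Matrix (Fin 2) (Fin 2) (A q)} (hD : ∀ x, h (D x 0 1) = 0)
    (hDa : D (a q) = !![(q : ℂ) • a q, b q; 0, a q])
    (hDb : D (b q) = !![(q : ℂ)⁻¹ • b q, 0; 0, b q])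
    (hDc : D (c q) = !![(q : ℂ) • c q, d q; 0, c q]) :
    h ((b q * c q) ^ k * (d q * a q)) =
      (q : ℂ) ^ (2 * k + 2) * h ((b q * c q) ^ k * (a q * d q)) := by
  have h0 := hD ((b q * c q) ^ k * c q * a q)
  rw [map_mul, rightMatrixAction_b_mul_c_pow_mul_c hq hDb hDc, hDa] at h0
  simp only [Matrix.mul_apply, Fin.sum_univ_two, Matrix.of_apply, Matrix.cons_val_zero,
    Matrix.cons_val_one, smul_mul_assoc, map_add, map_smul, smul_eq_mul] at h0
  rw [mul_assoc, mul_assoc, ← (commute_b_c (q := q)).eq, d_mul_a, ← pow_succ, mul_add, mul_one,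
    mul_smul_comm, ← pow_succ, map_add, map_smul, smul_eq_mul] at h0
  rw [a_mul_d, d_mul_a, mul_add, mul_add, mul_one, mul_smul_comm, mul_smul_comm, ← pow_succ,
    map_add, map_add, map_smul, map_smul, smul_eq_mul, smul_eq_mul]
  have hs := geom_sum_mul ((q : ℂ)⁻¹ ^ 2) (k + 1)
  generalize ∑ i ∈ Finset.range (k + 1), ((q : ℂ)⁻¹ ^ 2) ^ i = s at h0 hs
  generalize h ((b q * c q) ^ k) = t at h0 ⊢
  generalize h ((b q * c q) ^ (k + 1)) = t' at h0 ⊢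
  have hs' : s * (1 - (q : ℂ) ^ 2) * (q : ℂ) ^ (2 * k) = 1 - (q : ℂ) ^ (2 * k + 2) := by
    have h2 : (q : ℂ)⁻¹ ^ 2 * (q : ℂ) ^ 2 = 1 := by
      rw [← mul_pow, inv_mul_cancel₀ hq, one_pow]
    have hk : ((q : ℂ)⁻¹ ^ 2) ^ (k + 1) * (q : ℂ) ^ (2 * k + 2) = 1 := by
      rw [show 2 * k + 2 = 2 * (k + 1) by ring, pow_mul, ← mul_pow, h2, one_pow]
    linear_combination (q : ℂ) ^ (2 * k + 2) * hs + hk - s * (q : ℂ) ^ (2 * k) * h2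
  have hinv : (q : ℂ) * (q : ℂ)⁻¹ = 1 := mul_inv_cancel₀ hq
  linear_combination (1 - (q : ℂ) ^ 2) * (q : ℂ) ^ (2 * k) * h0 - (t + (q : ℂ)⁻¹ * t') * hs' +
    (q : ℂ) ^ (2 * k) * (q : ℂ) * t' * hinv

end Recursion

section Modularity

variable {l r : A q →ₐ[ℂ] A q} {h : A q →ₗ[ℂ] ℂ}

theorem haar_mul_eq_of_monomials (hq : (q : ℂ) ≠ 0) {y : A q} {t : ℂ}
    (hy : ∀ x ∈ monomials q, h (x * y) = t * h (y * x)) (x : A q) :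
    h (x * y) = t * h (y * x) := by
  have key : h.comp (LinearMap.mulRight ℂ y) = t • h.comp (LinearMap.mulLeft ℂ y) :=
    LinearMap.ext_on (span_monomials hq) fun x hx => by simpa using hy x hx
  simpa using LinearMap.congr_fun key x

theorem haar_mul_b (hq0 : 0 < q) (hq1 : q < 1) (hlr : IsTorusPair l r)
    (hl : ∀ x, h (l x) = h x) (hr : ∀ x, h (r x) = h x) (x : A q) :
    h (x * b q) = h (b q * x) := by
  have hq : (q : ℂ) ≠ 0 := Complex.ofReal_ne_zero.2 hq0.ne'
  have hcomm (j k : ℕ) : Commute (b q ^ j * c q ^ k) (b q) :=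
    ((Commute.refl _).pow_left j).mul_left (commute_b_c.symm.pow_left k)
  rw [haar_mul_eq_of_monomials hq (t := 1) _ x, one_mul]
  rintro _ ⟨j, k, i, rfl | rfl⟩
  · rcases eq_or_ne i 0 with rfl | hi
    · rw [pow_zero, mul_one, (hcomm j k).eq, one_mul]
    · exact (hlr.hasWeight_monomial_a hq j k i).haar_mul_eq hq0 hq1 hl hr hlr.hasWeight_b
        (by omega) 1
  · rcases eq_or_ne i 0 with rfl | hi
    · rw [pow_zero, mul_one, (hcomm j k).eq, one_mul]
    · exact (hlr.hasWeight_monomial_d hq j k i).haar_mul_eq hq0 hq1 hl hr hlr.hasWeight_b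
        (by omega) 1

theorem haar_mul_c (hq0 : 0 < q) (hq1 : q < 1) (hlr : IsTorusPair l r)
    (hl : ∀ x, h (l x) = h x) (hr : ∀ x, h (r x) = h x) (x : A q) :
    h (x * c q) = h (c q * x) := by
  have hq : (q : ℂ) ≠ 0 := Complex.ofReal_ne_zero.2 hq0.ne'
  have hcomm (j k : ℕ) : Commute (b q ^ j * c q ^ k) (c q) :=
    (commute_b_c.pow_left j).mul_left ((Commute.refl _).pow_left k)
  rw [haar_mul_eq_of_monomials hq (t := 1) _ x, one_mul]
  rintro _ ⟨j, k, i, rfl | rfl⟩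
  · rcases eq_or_ne i 0 with rfl | hi
    · rw [pow_zero, mul_one, (hcomm j k).eq, one_mul]
    · exact (hlr.hasWeight_monomial_a hq j k i).haar_mul_eq hq0 hq1 hl hr hlr.hasWeight_c
        (by omega) 1
  · rcases eq_or_ne i 0 with rfl | hi
    · rw [pow_zero, mul_one, (hcomm j k).eq, one_mul]
    · exact (hlr.hasWeight_monomial_d hq j k i).haar_mul_eq hq0 hq1 hl hr hlr.hasWeight_c
        (by omega) 1

theorem haar_mul_a (hq0 : 0 < q) (hq1 : q < 1) (hlr : IsTorusPair l r)
    (hl : ∀ x, h (l x) = h x) (hr : ∀ x, h (r x) = h x)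
    (hrec : ∀ k : ℕ, h ((b q * c q) ^ k * (d q * a q)) =
      (q : ℂ) ^ (2 * k + 2) * h ((b q * c q) ^ k * (a q * d q))) (x : A q) :
    h (x * a q) = (q : ℂ) ^ 2 * h (a q * x) := by
  have hq : (q : ℂ) ≠ 0 := Complex.ofReal_ne_zero.2 hq0.ne'
  refine haar_mul_eq_of_monomials hq ?_ x
  rintro _ ⟨j, k, i, rfl | rfl⟩
  · exact (hlr.hasWeight_monomial_a hq j k i).haar_mul_eq hq0 hq1 hl hr hlr.hasWeight_a
      (by omega) _
  · by_cases hi : i = 1 ∧ j = k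
    · obtain ⟨rfl, rfl⟩ := hi
      rw [pow_one, ← mul_assoc, a_mul_pow_mul_pow, smul_mul_assoc, map_smul, mul_assoc _ (d q),
        mul_assoc _ (a q), ← commute_b_c.mul_pow, hrec, smul_eq_mul]
      ring
    · exact (hlr.hasWeight_monomial_d hq j k i).haar_mul_eq hq0 hq1 hl hr hlr.hasWeight_a
        (by omega) _

theorem haar_mul_d (hq0 : 0 < q) (hq1 : q < 1) (hlr : IsTorusPair l r)
    (hl : ∀ x, h (l x) = h x) (hr : ∀ x, h (r x) = h x)
    (hrec : ∀ k : ℕ, h ((b q * c q) ^ k * (d q * a q)) =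
      (q : ℂ) ^ (2 * k + 2) * h ((b q * c q) ^ k * (a q * d q))) (x : A q) :
    h (x * d q) = (q : ℂ)⁻¹ ^ 2 * h (d q * x) := by
  have hq : (q : ℂ) ≠ 0 := Complex.ofReal_ne_zero.2 hq0.ne'
  refine haar_mul_eq_of_monomials hq ?_ x
  rintro _ ⟨j, k, i, rfl | rfl⟩
  · by_cases hi : i = 1 ∧ j = k
    · obtain ⟨rfl, rfl⟩ := hi
      rw [pow_one, ← mul_assoc, d_mul_pow_mul_pow hq, smul_mul_assoc, map_smul,
        mul_assoc _ (d q), mul_assoc _ (a q), ← commute_b_c.mul_pow, hrec, smul_eq_mul]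
      simp only [inv_pow]
      field_simp
      ring
    · exact (hlr.hasWeight_monomial_a hq j k i).haar_mul_eq hq0 hq1 hl hr hlr.hasWeight_d
        (by omega) _
  · exact (hlr.hasWeight_monomial_d hq j k i).haar_mul_eq hq0 hq1 hl hr hlr.hasWeight_d
      (by omega) _

theorem haar_mul_eq_haar_translation_mul (hq0 : 0 < q) (hq1 : q < 1) (hlr : IsTorusPair l r)
    (hl : ∀ x, h (l x) = h x) (hr : ∀ x, h (r x) = h x)
    (hrec : ∀ k : ℕ, h ((b q * c q) ^ k * (d q * a q)) =
      (q : ℂ) ^ (2 * k + 2) * h ((b q * c q) ^ k * (a q * d q))) (y x : A q) :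
    h (x * y) = h (l (r y) * x) := by
  have hq : (q : ℂ) ≠ 0 := Complex.ofReal_ne_zero.2 hq0.ne'
  let S : Subalgebra ℂ (A q) :=
    { carrier := {y | ∀ x, h (x * y) = h (l (r y) * x)}
      mul_mem' := fun {y z} hy hz x => by
        rw [← mul_assoc, hz, ← mul_assoc, hy, map_mul r, map_mul l, mul_assoc]
      add_mem' := fun {y z} hy hz x => by
        rw [mul_add, map_add, hy, hz, map_add, map_add, add_mul, map_add]
      algebraMap_mem' := fun t x => by
        rw [AlgHom.commutes, AlgHom.commutes, Algebra.commutes] }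
  have hS : S = ⊤ := by
    apply eq_top_of_generators_mem <;> intro x
    · rw [haar_mul_a hq0 hq1 hlr hl hr hrec, hlr.right_a, map_smul, hlr.left_a, smul_smul,
        smul_mul_assoc, map_smul, smul_eq_mul, sq]
    · rw [haar_mul_b hq0 hq1 hlr hl hr, hlr.right_b, map_smul, hlr.left_b, inv_smul_smul₀ hq]
    · rw [haar_mul_c hq0 hq1 hlr hl hr, hlr.right_c, map_smul, hlr.left_c, smul_inv_smul₀ hq]
    · rw [haar_mul_d hq0 hq1 hlr hl hr hrec, hlr.right_d, map_smul, hlr.left_d, smul_smul,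
        smul_mul_assoc, map_smul, smul_eq_mul, sq]
  have hy : y ∈ S := hS ▸ Algebra.mem_top
  exact hy x

end Modularity

section Grading

/-- Evaluation of Laurent polynomials at a nonzero complex number. -/
def torusEval (u : ℂˣ) : LaurentPolynomial ℂ →ₐ[ℂ] ℂ :=
  { LaurentPolynomial.eval₂ (RingHom.id ℂ) u with
    commutes' := fun t => LaurentPolynomial.eval₂_C (RingHom.id ℂ) u t }

theorem torusEval_T (u : ℂˣ) (n : ℤ) : torusEval u (T n) = (u : ℂ) ^ n :=
  (LaurentPolynomial.eval₂_T (RingHom.id ℂ) u n).trans (Units.val_zpow_eq_zpow_val u n)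

variable {Δ : A q →ₐ[ℂ] A q ⊗[ℂ] A q} {φ : A q →ₐ[ℂ] LaurentPolynomial ℂ} {m n : ℤ} {y : A q}

theorem leftTranslation_comp_of_mem (hy : y ∈ Asub Δ φ m n)
    (ε : LaurentPolynomial ℂ →ₐ[ℂ] ℂ) :
    leftTranslation Δ (ε.comp φ) y = ε (T m) • y := by
  have key : ∀ t : A q ⊗[ℂ] A q,
      Algebra.TensorProduct.lid ℂ (A q)
        (Algebra.TensorProduct.map (ε.comp φ) (AlgHom.id ℂ (A q)) t) =
      TensorProduct.lid ℂ (A q) (TensorProduct.map ε.toLinearMap LinearMap.id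
        (TensorProduct.map φ.toLinearMap LinearMap.id t)) := by
    intro t
    induction t with
    | zero => simp
    | tmul x y => simp
    | add x y hx hy => simp only [map_add, hx, hy]
  have h1 : TensorProduct.map φ.toLinearMap LinearMap.id (Δ y) = T m ⊗ₜ[ℂ] y := hy.1
  refine (key (Δ y)).trans ?_
  rw [h1]
  simp

theorem rightTranslation_comp_of_mem (hy : y ∈ Asub Δ φ m n)
    (ε : LaurentPolynomial ℂ →ₐ[ℂ] ℂ) :
    rightTranslation Δ (ε.comp φ) y = ε (T n) • y := by
  have key : ∀ t : A q ⊗[ℂ] A q,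
      Algebra.TensorProduct.rid ℂ ℂ (A q)
        (Algebra.TensorProduct.map (AlgHom.id ℂ (A q)) (ε.comp φ) t) =
      TensorProduct.rid ℂ (A q) (TensorProduct.map LinearMap.id ε.toLinearMap
        (TensorProduct.map LinearMap.id φ.toLinearMap t)) := by
    intro t
    induction t with
    | zero => simp
    | tmul x y => simp
    | add x y hx hy => simp only [map_add, hx, hy]
  have h1 : TensorProduct.map LinearMap.id φ.toLinearMap (Δ y) = y ⊗ₜ[ℂ] T n := hy.2
  refine (key (Δ y)).trans ?_
  rw [h1]
  simp

end Grading

/-- The Haar state satisfies the modular property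
`h(xy) = q^{m+n} h(yx)` for `y ∈ A[m,n]`. -/
theorem slq2_haar_modular_property (q : ℝ) (hq0 : 0 < q) (hq1 : q < 1)
    (Δ : A q →ₐ[ℂ] A q ⊗[ℂ] A q)
    (hΔa : Δ (a q) = a q ⊗ₜ[ℂ] a q + b q ⊗ₜ[ℂ] c q)
    (hΔb : Δ (b q) = a q ⊗ₜ[ℂ] b q + b q ⊗ₜ[ℂ] d q)
    (hΔc : Δ (c q) = c q ⊗ₜ[ℂ] a q + d q ⊗ₜ[ℂ] c q)
    (hΔd : Δ (d q) = c q ⊗ₜ[ℂ] b q + d q ⊗ₜ[ℂ] d q)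
    (φ : A q →ₐ[ℂ] LaurentPolynomial ℂ)
    (hφa : φ (a q) = T 1) (hφb : φ (b q) = 0)
    (hφc : φ (c q) = 0) (hφd : φ (d q) = T (-1))
    (h : A q →ₗ[ℂ] ℂ) (hh : IsHaarState Δ h) :
    ∀ (m n : ℤ) (x y : A q), y ∈ Asub Δ φ m n →
      h (x * y) = (q : ℂ) ^ (m + n) * h (y * x) := by
  have hq : (q : ℂ) ≠ 0 := Complex.ofReal_ne_zero.2 hq0.ne'
  let u : ℂˣ := Units.mk0 (q : ℂ) hq
  let χ : A q →ₐ[ℂ] ℂ := (torusEval u).comp φ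
  have hχa : χ (a q) = q := by simp [χ, u, hφa, torusEval_T]
  have hχb : χ (b q) = 0 := by simp [χ, hφb]
  have hχc : χ (c q) = 0 := by simp [χ, hφc]
  have hχd : χ (d q) = (q : ℂ)⁻¹ := by simp [χ, u, hφd, torusEval_T]
  have hlr : IsTorusPair (leftTranslation Δ χ) (rightTranslation Δ χ) := by
    constructor <;>
      simp [leftTranslation, rightTranslation, hΔa, hΔb, hΔc, hΔd, hχa, hχb, hχc, hχd,
        -Complex.coe_smul, -Complex.ofReal_inv]
  have hl := haar_leftTranslation hh χ
  have hr := haar_rightTranslation hh χ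
  have hD := haar_rightMatrixAction hh (skewRep hq)
  have hDa : rightMatrixAction Δ (skewRep hq) (a q) = !![(q : ℂ) • a q, b q; 0, a q] := by
    ext i j
    fin_cases i <;> fin_cases j <;>
      simp [rightMatrixAction, hΔa, skewRep_a, skewRep_c, matrixEquivTensor_apply_symm,
        Algebra.smul_def, Algebra.commutes]
  have hDb : rightMatrixAction Δ (skewRep hq) (b q) = !![(q : ℂ)⁻¹ • b q, 0; 0, b q] := by
    ext i j
    fin_cases i <;> fin_cases j <;>
      simp [rightMatrixAction, hΔb, skewRep_b, skewRep_d, matrixEquivTensor_apply_symm,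
        Algebra.smul_def, Algebra.commutes]
  have hDc : rightMatrixAction Δ (skewRep hq) (c q) = !![(q : ℂ) • c q, d q; 0, c q] := by
    ext i j
    fin_cases i <;> fin_cases j <;>
      simp [rightMatrixAction, hΔc, skewRep_a, skewRep_c, matrixEquivTensor_apply_symm,
        Algebra.smul_def, Algebra.commutes]
  have hmod := haar_mul_eq_haar_translation_mul hq0 hq1 hlr hl hr
    fun k => haar_b_mul_c_pow_mul_d_mul_a hq k hD hDa hDb hDc
  intro m n x y hy
  have hyl : leftTranslation Δ χ y = (q : ℂ) ^ m • y := by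
    rw [leftTranslation_comp_of_mem hy, torusEval_T]; simp [u]
  have hyr : rightTranslation Δ χ y = (q : ℂ) ^ n • y := by
    rw [rightTranslation_comp_of_mem hy, torusEval_T]; simp [u]
  rw [hmod y x, hyr, map_smul, hyl, smul_smul, smul_mul_assoc, map_smul, smul_eq_mul,
    ← zpow_add₀ hq, add_comm n]

end SLq2
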